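/- Let n ≥ 1 be an integer. Let u be a smooth positive ancient solution of the heat equation u_t = Δu on ℝⁿ × (−∞, t₀]. Fix x₀ ∈ ℝⁿ. If sup over B(x₀,R) × [t₀ − R², t₀] of u is o(R²) as R → ∞, then u is constant. -/

import Mathlib

open Metric Set Filter

/-- The Laplacian (in the spatial variable) of a function on `ℝⁿ`, computed as the sum
of the second partial derivatives along the standard coordinate directions. -/
noncomputable def lap {n : ℕ} (f : EuclideanSpace ℝ (Fin n) → ℝ)
    (x : EuclideanSpace ℝ (Fin n)) : ℝ :=
  ∑ i : Fin n,
    fderiv ℝ (fun y => fderiv ℝ f y (EuclideanSpace.single i 1)) x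
      (EuclideanSpace.single i 1)

open scoped ContDiff Topology

section DirectionalDerivative

variable {V : Type*} [NormedAddCommGroup V] [NormedSpace ℝ V] {U : Set V} {f g : V → ℝ} {p : V}

/-- The directional derivative of `f` in the direction `v`, as a function of the point. -/
noncomputable def dirDeriv (v : V) (f : V → ℝ) (p : V) : ℝ := fderiv ℝ f p v

theorem ContDiffOn.dirDeriv (hf : ContDiffOn ℝ ∞ f U) (hU : IsOpen U) (v : V) :
    ContDiffOn ℝ ∞ (dirDeriv v f) U :=
  (hf.fderiv_of_isOpen hU (by simp)).clm_apply contDiffOn_const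

theorem ContDiffOn.differentiableAt_of_isOpen (hf : ContDiffOn ℝ ∞ f U) (hU : IsOpen U)
    (hp : p ∈ U) : DifferentiableAt ℝ f p :=
  (hf.contDiffAt (hU.mem_nhds hp)).differentiableAt (by simp)

theorem dirDeriv_congr (hU : IsOpen U) (h : EqOn f g U) (v : V) :
    EqOn (dirDeriv v f) (dirDeriv v g) U := fun p hp => by
  have : f =ᶠ[𝓝 p] g := Filter.eventuallyEq_of_mem (hU.mem_nhds hp) h
  simp only [dirDeriv, this.fderiv_eq]

theorem dirDeriv_add (hf : DifferentiableAt ℝ f p) (hg : DifferentiableAt ℝ g p) (v : V) :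
    dirDeriv v (fun q => f q + g q) p = dirDeriv v f p + dirDeriv v g p := by
  simp [dirDeriv, fderiv_fun_add hf hg]

theorem dirDeriv_mul (hf : DifferentiableAt ℝ f p) (hg : DifferentiableAt ℝ g p) (v : V) :
    dirDeriv v (fun q => f q * g q) p = f p * dirDeriv v g p + g p * dirDeriv v f p := by
  simp [dirDeriv, fderiv_fun_mul hf hg]

theorem dirDeriv_sum {ι : Type*} (s : Finset ι) {F : ι → V → ℝ}
    (hF : ∀ i ∈ s, DifferentiableAt ℝ (F i) p) (v : V) :
    dirDeriv v (fun q => ∑ i ∈ s, F i q) p = ∑ i ∈ s, dirDeriv v (F i) p := by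
  simp [dirDeriv, fderiv_fun_sum hF]

theorem dirDeriv_comm (hf : ContDiffOn ℝ ∞ f U) (hU : IsOpen U) (hp : p ∈ U) (v w : V) :
    dirDeriv v (dirDeriv w f) p = dirDeriv w (dirDeriv v f) p := by
  have hd : DifferentiableAt ℝ (fderiv ℝ f) p :=
    ((hf.fderiv_of_isOpen (m := ∞) hU (by simp)).contDiffAt (hU.mem_nhds hp)).differentiableAt
      (by simp)
  have key (a b : V) : dirDeriv a (dirDeriv b f) p = fderiv ℝ (fderiv ℝ f) p a b := by
    change fderiv ℝ (fun q => fderiv ℝ f q b) p a = _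
    rw [fderiv_clm_apply hd (differentiableAt_const b)]
    simp
  have hs := (hf.contDiffAt (hU.mem_nhds hp)).isSymmSndFDerivAt
    (by simpa using WithTop.coe_le_coe.2 (le_top : (2 : ℕ∞) ≤ ⊤))
  rw [key, key, hs.eq]

theorem hasDerivAt_comp_add_smul (v : V) (s : ℝ) (hf : DifferentiableAt ℝ f (p + s • v)) :
    HasDerivAt (fun r : ℝ => f (p + r • v)) (dirDeriv v f (p + s • v)) s := by
  have h : HasDerivAt (fun r : ℝ => p + r • v) v s := by
    simpa using ((hasDerivAt_id s).smul_const v).const_add p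
  exact hf.hasFDerivAt.comp_hasDerivAt s h

theorem IsLocalMax.deriv_deriv_nonpos {φ : ℝ → ℝ} {a : ℝ} (h : IsLocalMax φ a)
    (hc : ContinuousAt φ a) : deriv (deriv φ) a ≤ 0 := by
  by_contra! hpos
  have hmin := isLocalMin_of_deriv_deriv_pos hpos h.deriv_eq_zero hc
  have hconst : φ =ᶠ[𝓝 a] fun _ => φ a := by
    filter_upwards [h, hmin] with x h1 h2 using le_antisymm h1 h2
  have := hconst.deriv.deriv_eq
  simp at this
  linarith

theorem IsLocalMax.dirDeriv_dirDeriv_nonpos (hf : ContDiffOn ℝ ∞ f U) (hU : IsOpen U)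
    (hp : p ∈ U) (h : IsLocalMax f p) (v : V) : dirDeriv v (dirDeriv v f) p ≤ 0 := by
  have hline : ContinuousAt (fun r : ℝ => p + r • v) 0 := by fun_prop
  have hmem : ∀ᶠ r : ℝ in 𝓝 0, p + r • v ∈ U :=
    hline.eventually_mem (by simpa using hU.mem_nhds hp)
  have hd1 : deriv (fun r : ℝ => f (p + r • v)) =ᶠ[𝓝 0] fun r => dirDeriv v f (p + r • v) := by
    filter_upwards [hmem] with r hr
    exact (hasDerivAt_comp_add_smul v r (hf.differentiableAt_of_isOpen hU hr)).deriv
  have hd2 : deriv (fun r : ℝ => dirDeriv v f (p + r • v)) 0 = dirDeriv v (dirDeriv v f) p := by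
    have := (hasDerivAt_comp_add_smul (p := p) v 0
      ((hf.dirDeriv hU v).differentiableAt_of_isOpen hU (by simpa using hp))).deriv
    simpa using this
  have hmax : IsLocalMax (fun r : ℝ => f (p + r • v)) 0 := by
    have h' : ∀ᶠ q in 𝓝 (p + (0 : ℝ) • v), f q ≤ f p := by
      simpa [IsLocalMax, IsMaxFilter] using h
    simpa [IsLocalMax, IsMaxFilter] using hline.eventually h'
  have hc : ContinuousAt (fun r : ℝ => f (p + r • v)) 0 :=
    (hasDerivAt_comp_add_smul v 0
      (hf.differentiableAt_of_isOpen hU (by simpa using hp))).continuousAt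
  have := hmax.deriv_deriv_nonpos hc
  rwa [hd1.deriv_eq, hd2] at this

end DirectionalDerivative

section HeatOperator

variable {n : ℕ} {U : Set (EuclideanSpace ℝ (Fin n) × ℝ)}
  {f g u : EuclideanSpace ℝ (Fin n) × ℝ → ℝ} {p : EuclideanSpace ℝ (Fin n) × ℝ}

/-- The `i`-th spatial unit vector of space-time. -/
noncomputable def spaceDir (i : Fin n) : EuclideanSpace ℝ (Fin n) × ℝ :=
  (EuclideanSpace.single i 1, 0)

/-- The heat operator `∂ₜ - Δ`. -/
noncomputable def heatOp (f : EuclideanSpace ℝ (Fin n) × ℝ → ℝ)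
    (p : EuclideanSpace ℝ (Fin n) × ℝ) : ℝ :=
  dirDeriv (0, 1) f p - ∑ i, dirDeriv (spaceDir i) (dirDeriv (spaceDir i) f) p

theorem heatOp_add (hU : IsOpen U) (hf : ContDiffOn ℝ ∞ f U) (hg : ContDiffOn ℝ ∞ g U)
    (hp : p ∈ U) : heatOp (fun q => f q + g q) p = heatOp f p + heatOp g p := by
  have h2 (i : Fin n) : dirDeriv (spaceDir i) (dirDeriv (spaceDir i) fun q => f q + g q) p =
      dirDeriv (spaceDir i) (dirDeriv (spaceDir i) f) p +
        dirDeriv (spaceDir i) (dirDeriv (spaceDir i) g) p := by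
    rw [dirDeriv_congr hU (fun q hq => dirDeriv_add (hf.differentiableAt_of_isOpen hU hq)
        (hg.differentiableAt_of_isOpen hU hq) _) _ hp,
      dirDeriv_add ((hf.dirDeriv hU _).differentiableAt_of_isOpen hU hp)
        ((hg.dirDeriv hU _).differentiableAt_of_isOpen hU hp)]
  simp only [heatOp, h2, Finset.sum_add_distrib]
  rw [dirDeriv_add (hf.differentiableAt_of_isOpen hU hp) (hg.differentiableAt_of_isOpen hU hp)]
  ring

theorem heatOp_mul (hU : IsOpen U) (hf : ContDiffOn ℝ ∞ f U) (hg : ContDiffOn ℝ ∞ g U)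
    (hp : p ∈ U) : heatOp (fun q => f q * g q) p = f p * heatOp g p + g p * heatOp f p -
      2 * ∑ i, dirDeriv (spaceDir i) f p * dirDeriv (spaceDir i) g p := by
  have hf0 {q} (hq : q ∈ U) := hf.differentiableAt_of_isOpen hU hq
  have hg0 {q} (hq : q ∈ U) := hg.differentiableAt_of_isOpen hU hq
  have hf1 (i : Fin n) := (hf.dirDeriv hU (spaceDir i)).differentiableAt_of_isOpen hU hp
  have hg1 (i : Fin n) := (hg.dirDeriv hU (spaceDir i)).differentiableAt_of_isOpen hU hp
  have h2 (i : Fin n) : dirDeriv (spaceDir i) (dirDeriv (spaceDir i) fun q => f q * g q) p =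
      f p * dirDeriv (spaceDir i) (dirDeriv (spaceDir i) g) p +
        g p * dirDeriv (spaceDir i) (dirDeriv (spaceDir i) f) p +
        2 * (dirDeriv (spaceDir i) f p * dirDeriv (spaceDir i) g p) := by
    rw [dirDeriv_congr hU (fun q hq => dirDeriv_mul (hf0 hq) (hg0 hq) _) _ hp,
      dirDeriv_add ((hf0 hp).fun_mul (hg1 i)) ((hg0 hp).fun_mul (hf1 i)),
      dirDeriv_mul (hf0 hp) (hg1 i), dirDeriv_mul (hg0 hp) (hf1 i)]
    ring
  simp only [heatOp, h2, Finset.sum_add_distrib, ← Finset.mul_sum]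
  rw [dirDeriv_mul (hf0 hp) (hg0 hp)]
  ring

/-- `u` is a smooth solution of the heat equation on `U`. -/
structure IsCaloricOn (u : EuclideanSpace ℝ (Fin n) × ℝ → ℝ)
    (U : Set (EuclideanSpace ℝ (Fin n) × ℝ)) : Prop where
  smooth : ContDiffOn ℝ ∞ u U
  heatOp_eq_zero : ∀ p ∈ U, heatOp u p = 0

theorem IsCaloricOn.dirDeriv (hu : IsCaloricOn u U) (hU : IsOpen U)
    (v : EuclideanSpace ℝ (Fin n) × ℝ) : IsCaloricOn (dirDeriv v u) U where
  smooth := hu.smooth.dirDeriv hU v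
  heatOp_eq_zero p hp := by
    have hs := hu.smooth
    have heq : EqOn (_root_.dirDeriv (0, 1) u)
        (fun q => ∑ i, _root_.dirDeriv (spaceDir i) (_root_.dirDeriv (spaceDir i) u) q) U :=
      fun q hq => sub_eq_zero.mp (hu.heatOp_eq_zero q hq)
    have h2 (i : Fin n) :
        _root_.dirDeriv (spaceDir i) (_root_.dirDeriv (spaceDir i) (_root_.dirDeriv v u)) p =
          _root_.dirDeriv v (_root_.dirDeriv (spaceDir i) (_root_.dirDeriv (spaceDir i) u)) p := by
      rw [dirDeriv_congr hU (fun q hq => dirDeriv_comm hs hU hq _ v) _ hp,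
        dirDeriv_comm (hs.dirDeriv hU _) hU hp]
    simp only [heatOp, h2]
    rw [dirDeriv_comm hs hU hp, dirDeriv_congr hU heq _ hp, dirDeriv_sum _ fun i _ =>
      ((hs.dirDeriv hU _).dirDeriv hU _).differentiableAt_of_isOpen hU hp, sub_self]

theorem dirDeriv_slice {a : EuclideanSpace ℝ (Fin n)} {s : ℝ}
    (hf : DifferentiableAt ℝ f (a, s)) (v : EuclideanSpace ℝ (Fin n)) :
    dirDeriv v (fun y => f (y, s)) a = dirDeriv (v, 0) f (a, s) := by
  have h : HasFDerivAt (fun y : EuclideanSpace ℝ (Fin n) => (y, s))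
      (ContinuousLinearMap.inl ℝ (EuclideanSpace ℝ (Fin n)) ℝ) a :=
    hasFDerivAt_prodMk_left a s
  have h' : HasFDerivAt (fun y => f (y, s)) _ a := hf.hasFDerivAt.comp a h
  simp [dirDeriv, h'.fderiv]

theorem dirDeriv_dirDeriv_slice {a : EuclideanSpace ℝ (Fin n)} {s : ℝ} (hU : IsOpen U)
    (hf : ContDiffOn ℝ ∞ f U) (hp : (a, s) ∈ U) (v : EuclideanSpace ℝ (Fin n)) :
    dirDeriv v (dirDeriv v fun y => f (y, s)) a = dirDeriv (v, 0) (dirDeriv (v, 0) f) (a, s) := by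
  have hU' : IsOpen ((fun y : EuclideanSpace ℝ (Fin n) => (y, s)) ⁻¹' U) :=
    hU.preimage (by fun_prop)
  rw [dirDeriv_congr hU' (fun y hy => dirDeriv_slice (hf.differentiableAt_of_isOpen hU hy) v) v hp,
    dirDeriv_slice ((hf.dirDeriv hU _).differentiableAt_of_isOpen hU hp)]

/-- The closed parabolic cylinder of radius `R` with top centre `(x, t)`. -/
def paraCylinder (x : EuclideanSpace ℝ (Fin n)) (t R : ℝ) :
    Set (EuclideanSpace ℝ (Fin n) × ℝ) :=
  closedBall x R ×ˢ Icc (t - R ^ 2) t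

theorem isCompact_paraCylinder (x : EuclideanSpace ℝ (Fin n)) (t R : ℝ) :
    IsCompact (paraCylinder x t R) :=
  (isCompact_closedBall x R).prod isCompact_Icc

/-- At a maximum over a parabolic cylinder off the parabolic boundary, the heat operator is
nonnegative. -/
theorem IsMaxOn.heatOp_nonneg {x : EuclideanSpace ℝ (Fin n)} {t R : ℝ} (hU : IsOpen U)
    (hf : ContDiffOn ℝ ∞ f U) (hQ : paraCylinder x t R ⊆ U) (hp : p ∈ paraCylinder x t R)
    (hmax : IsMaxOn f (paraCylinder x t R) p) (hx : ‖p.1 - x‖ < R) (ht : t - R ^ 2 < p.2) :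
    0 ≤ heatOp f p := by
  obtain ⟨a, s⟩ := p
  have hpU := hQ hp
  have hd := hf.differentiableAt_of_isOpen hU hpU
  have htime : 0 ≤ dirDeriv (0, 1) f (a, s) := by
    have hQ' : Convex ℝ (paraCylinder x t R) := (convex_closedBall x R).prod (convex_Icc _ _)
    have hq : (a, t - R ^ 2) ∈ paraCylinder x t R :=
      ⟨hp.1, le_rfl, by simp; positivity⟩
    have := hmax.localize.hasFDerivWithinAt_nonpos hd.hasFDerivAt.hasFDerivWithinAt
      (sub_mem_posTangentConeAt_of_segment_subset (hQ'.segment_subset hp hq))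
    have hv : ((a, t - R ^ 2) - (a, s) : EuclideanSpace ℝ (Fin n) × ℝ) =
        (t - R ^ 2 - s) • ((0, 1) : EuclideanSpace ℝ (Fin n) × ℝ) := by ext <;> simp
    rw [hv, map_smul, smul_eq_mul] at this
    simp only at ht
    exact nonneg_of_mul_nonpos_right this (by linarith)
  have hspace (i : Fin n) : dirDeriv (spaceDir i) (dirDeriv (spaceDir i) f) (a, s) ≤ 0 := by
    have hg : ContDiffOn ℝ ∞ (fun y => f (y, s)) ((fun y => (y, s)) ⁻¹' U) :=
      hf.comp (by fun_prop) fun y hy => hy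
    have hU' : IsOpen ((fun y : EuclideanSpace ℝ (Fin n) => (y, s)) ⁻¹' U) :=
      hU.preimage (by fun_prop)
    have hloc : IsLocalMax (fun y => f (y, s)) a := by
      filter_upwards [isOpen_ball.mem_nhds (show a ∈ ball x R by simpa [dist_eq_norm] using hx)]
        with y hy
      exact hmax ⟨ball_subset_closedBall hy, hp.2⟩
    have h1 := hloc.dirDeriv_dirDeriv_nonpos hg hU' hpU (EuclideanSpace.single i 1)
    rwa [dirDeriv_dirDeriv_slice hU hf hpU] at h1
  have := Finset.sum_nonpos fun i (_ : i ∈ Finset.univ) => hspace i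
  simp only [heatOp]
  linarith

theorem hasFDerivAt_time (c : ℝ) : HasFDerivAt (fun q : EuclideanSpace ℝ (Fin n) × ℝ => q.2 - c)
    (ContinuousLinearMap.snd ℝ (EuclideanSpace ℝ (Fin n)) ℝ) p :=
  hasFDerivAt_snd.sub_const c

theorem dirDeriv_time (c : ℝ) (v : EuclideanSpace ℝ (Fin n) × ℝ) :
    dirDeriv v (fun q : EuclideanSpace ℝ (Fin n) × ℝ => q.2 - c) = fun _ => v.2 := by
  ext p
  simp [dirDeriv, (hasFDerivAt_time c).fderiv]

theorem dirDeriv_const (c : ℝ) (v : EuclideanSpace ℝ (Fin n) × ℝ) :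
    dirDeriv v (fun _ : EuclideanSpace ℝ (Fin n) × ℝ => c) = fun _ => 0 := by
  ext p
  simp [dirDeriv]

theorem heatOp_time (c : ℝ) :
    heatOp (fun q : EuclideanSpace ℝ (Fin n) × ℝ => q.2 - c) p = 1 := by
  simp [heatOp, dirDeriv_time, dirDeriv_const, spaceDir]

theorem heatOp_const_mul (hU : IsOpen U) (hf : ContDiffOn ℝ ∞ f U) (hp : p ∈ U) (c : ℝ) :
    heatOp (fun q => c * f q) p = c * heatOp f p := by
  rw [heatOp_mul hU contDiffOn_const hf hp]
  simp [heatOp, dirDeriv_const]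

theorem dirDeriv_radial (x : EuclideanSpace ℝ (Fin n)) (r : ℝ)
    (v : EuclideanSpace ℝ (Fin n) × ℝ) :
    dirDeriv v (fun q : EuclideanSpace ℝ (Fin n) × ℝ => r - ‖q.1 - x‖ ^ 2) =
      fun q => -2 * inner ℝ (q.1 - x) v.1 := by
  ext p
  have h := ((hasFDerivAt_fst (𝕜 := ℝ) (p := p)).sub_const x).norm_sq.const_sub r
  simp [dirDeriv, h.fderiv, inner_sub_left]

theorem dirDeriv_spaceDir_dirDeriv_radial (x : EuclideanSpace ℝ (Fin n)) (r : ℝ) (i : Fin n) :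
    dirDeriv (spaceDir i) (dirDeriv (spaceDir i)
      fun q : EuclideanSpace ℝ (Fin n) × ℝ => r - ‖q.1 - x‖ ^ 2) p = -2 := by
  rw [dirDeriv_radial]
  have h := (((hasFDerivAt_fst (𝕜 := ℝ) (p := p)).sub_const x).inner ℝ
    (hasFDerivAt_const (spaceDir i).1 p)).const_mul (-2)
  rw [dirDeriv, h.fderiv]
  simp [spaceDir]

theorem heatOp_radial (x : EuclideanSpace ℝ (Fin n)) (r : ℝ) :
    heatOp (fun q : EuclideanSpace ℝ (Fin n) × ℝ => r - ‖q.1 - x‖ ^ 2) p = 2 * n := by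
  simp only [heatOp, dirDeriv_spaceDir_dirDeriv_radial]
  simp [dirDeriv_radial]
  ring

/-- A cutoff vanishing on the parabolic boundary of `paraCylinder x t R`. -/
noncomputable def paraCutoff (x : EuclideanSpace ℝ (Fin n)) (t R : ℝ)
    (q : EuclideanSpace ℝ (Fin n) × ℝ) : ℝ :=
  (R ^ 2 - ‖q.1 - x‖ ^ 2) * (q.2 - (t - R ^ 2))

theorem contDiff_radial (x : EuclideanSpace ℝ (Fin n)) (r : ℝ) :
    ContDiff ℝ ∞ fun q : EuclideanSpace ℝ (Fin n) × ℝ => r - ‖q.1 - x‖ ^ 2 :=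
  contDiff_const.sub ((contDiff_fst.sub contDiff_const).norm_sq ℝ)

theorem contDiff_time (c : ℝ) :
    ContDiff ℝ ∞ fun q : EuclideanSpace ℝ (Fin n) × ℝ => q.2 - c :=
  contDiff_snd.sub contDiff_const

theorem contDiff_paraCutoff (x : EuclideanSpace ℝ (Fin n)) (t R : ℝ) :
    ContDiff ℝ ∞ (paraCutoff x t R) :=
  (contDiff_radial x _).mul (contDiff_time _)

theorem dirDeriv_paraCutoff (x : EuclideanSpace ℝ (Fin n)) (t R : ℝ) (i : Fin n) :
    dirDeriv (spaceDir i) (paraCutoff x t R) p =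
      -2 * (p.1 - x) i * (p.2 - (t - R ^ 2)) := by
  have h := dirDeriv_mul (((contDiff_radial x (R ^ 2)).differentiable (by simp)) p)
    (((contDiff_time (t - R ^ 2)).differentiable (by simp)) p) (spaceDir i)
  rw [dirDeriv_radial, dirDeriv_time] at h
  refine h.trans ?_
  simp only [spaceDir, EuclideanSpace.inner_single_right]
  simp
  ring

theorem heatOp_paraCutoff (x : EuclideanSpace ℝ (Fin n)) (t R : ℝ) :
    heatOp (paraCutoff x t R) p =
      (R ^ 2 - ‖p.1 - x‖ ^ 2) + 2 * n * (p.2 - (t - R ^ 2)) := by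
  have h := heatOp_mul isOpen_univ (contDiff_radial x (R ^ 2)).contDiffOn
    (contDiff_time (t - R ^ 2)).contDiffOn (mem_univ p)
  rw [heatOp_radial, heatOp_time] at h
  refine h.trans ?_
  simp [dirDeriv_time, spaceDir]
  ring

theorem sum_sq_dirDeriv_paraCutoff (x : EuclideanSpace ℝ (Fin n)) (t R : ℝ) :
    ∑ i, dirDeriv (spaceDir i) (paraCutoff x t R) p ^ 2 =
      4 * ‖p.1 - x‖ ^ 2 * (p.2 - (t - R ^ 2)) ^ 2 := by
  simp only [dirDeriv_paraCutoff, EuclideanSpace.norm_sq_eq, Finset.mul_sum, Finset.sum_mul]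
  refine Finset.sum_congr rfl fun i _ => ?_
  rw [Real.norm_eq_abs, sq_abs]
  ring

/-- The weak maximum principle for subsolutions of the heat equation. -/
theorem le_of_heatOp_nonpos {x : EuclideanSpace ℝ (Fin n)} {t R B : ℝ} (hU : IsOpen U)
    (hf : ContDiffOn ℝ ∞ f U) (hQ : paraCylinder x t R ⊆ U)
    (hsub : ∀ q ∈ paraCylinder x t R, ‖q.1 - x‖ < R → t - R ^ 2 < q.2 → heatOp f q ≤ 0)
    (hbd : ∀ q ∈ paraCylinder x t R, ‖q.1 - x‖ = R ∨ q.2 = t - R ^ 2 → f q ≤ B)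
    (hp : p ∈ paraCylinder x t R) : f p ≤ B := by
  have hτ : ContDiffOn ℝ ∞ (fun q : EuclideanSpace ℝ (Fin n) × ℝ => q.2 - (t - R ^ 2)) U :=
    (contDiff_time _).contDiffOn
  have key (ε : ℝ) (hε : 0 < ε) : f p + -ε * (p.2 - (t - R ^ 2)) ≤ B := by
    have hG : ContDiffOn ℝ ∞ (fun q => f q + -ε * (q.2 - (t - R ^ 2))) U :=
      hf.add (contDiffOn_const.mul hτ)
    obtain ⟨m, hmQ, hm⟩ := (isCompact_paraCylinder x t R).exists_isMaxOn ⟨p, hp⟩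
      (hG.continuousOn.mono hQ)
    refine (hm hp).trans ?_
    have hm1 : ‖m.1 - x‖ ≤ R := by simpa [dist_eq_norm] using hmQ.1
    have hm2 : t - R ^ 2 ≤ m.2 := hmQ.2.1
    by_cases hb : ‖m.1 - x‖ = R ∨ m.2 = t - R ^ 2
    · have := hbd m hmQ hb
      have := mul_nonneg hε.le (sub_nonneg.2 hm2)
      linarith
    · push Not at hb
      have h1 := lt_of_le_of_ne hm1 hb.1
      have h2 := lt_of_le_of_ne hm2 hb.2.symm
      have h3 := hm.heatOp_nonneg hU hG hQ hmQ h1 h2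
      rw [heatOp_add hU hf (contDiffOn_const.mul hτ) (hQ hmQ),
        heatOp_const_mul hU hτ (hQ hmQ), heatOp_time] at h3
      linarith [hsub m hmQ h1 h2]
  have hlim : Tendsto (fun ε : ℝ => f p + -ε * (p.2 - (t - R ^ 2))) (𝓝[>] 0) (𝓝 (f p)) := by
    have : Continuous fun ε : ℝ => f p + -ε * (p.2 - (t - R ^ 2)) := by fun_prop
    simpa using (this.tendsto 0).mono_left nhdsWithin_le_nhds
  exact le_of_tendsto hlim (by filter_upwards [self_mem_nhdsWithin] with ε hε using key ε hε)

/-- Bernstein's interior gradient estimate. -/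
theorem IsCaloricOn.sq_dirDeriv_le {x : EuclideanSpace ℝ (Fin n)} {t R K : ℝ} (hR : 0 < R)
    (hU : IsOpen U) (hu : IsCaloricOn u U) (hQ : paraCylinder x t R ⊆ U)
    (hK : ∀ q ∈ paraCylinder x t R, u q ^ 2 ≤ K) (j : Fin n) :
    R ^ 2 * _root_.dirDeriv (spaceDir j) u (x, t) ^ 2 ≤ (2 * n + 13) * K := by
  set v := _root_.dirDeriv (spaceDir j) u
  set η := paraCutoff x t R with hη
  set A : ℝ := R ^ 6 * (2 * n + 13) with hA
  have hvc : IsCaloricOn v U := hu.dirDeriv hU _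
  have hvs := hvc.smooth
  have hus := hu.smooth
  have hηs : ContDiffOn ℝ ∞ η U := (contDiff_paraCutoff x t R).contDiffOn
  have hws : ContDiffOn ℝ ∞ (fun q => η q * v q) U := hηs.mul hvs
  have hA0 : 0 ≤ A := by positivity
  have hsub : ∀ q ∈ paraCylinder x t R, ‖q.1 - x‖ < R → t - R ^ 2 < q.2 →
      heatOp (fun q => (η q * v q) * (η q * v q) + A * (u q * u q)) q ≤ 0 := by
    intro q hq hq1 hq2
    have hqU := hQ hq
    rw [heatOp_add hU (hws.mul hws) (contDiffOn_const.mul (hus.mul hus)) hqU,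
      heatOp_const_mul hU (hus.mul hus) hqU, heatOp_mul hU hws hws hqU,
      heatOp_mul hU hηs hvs hqU, heatOp_mul hU hus hus hqU, hu.heatOp_eq_zero q hqU,
      hvc.heatOp_eq_zero q hqU]
    have hgrad : v q ^ 2 ≤
        ∑ i, _root_.dirDeriv (spaceDir i) u q * _root_.dirDeriv (spaceDir i) u q := by
      rw [sq]
      exact Finset.single_le_sum
        (f := fun i => _root_.dirDeriv (spaceDir i) u q * _root_.dirDeriv (spaceDir i) u q)
        (fun i _ => mul_self_nonneg _) (Finset.mem_univ j)
    have hcross : -(6 * v q ^ 2 * ∑ i, _root_.dirDeriv (spaceDir i) η q ^ 2) ≤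
        4 * η q * v q *
            ∑ i, _root_.dirDeriv (spaceDir i) η q * _root_.dirDeriv (spaceDir i) v q +
          2 * ∑ i, _root_.dirDeriv (spaceDir i) (fun q => η q * v q) q *
            _root_.dirDeriv (spaceDir i) (fun q => η q * v q) q := by
      rw [Finset.mul_sum, Finset.mul_sum, Finset.mul_sum, ← Finset.sum_add_distrib,
        ← Finset.sum_neg_distrib]
      refine Finset.sum_le_sum fun i _ => ?_
      rw [dirDeriv_mul (hηs.differentiableAt_of_isOpen hU hqU)
        (hvs.differentiableAt_of_isOpen hU hqU)]
      linarith [sq_nonneg (η q * _root_.dirDeriv (spaceDir i) v q +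
        2 * (v q * _root_.dirDeriv (spaceDir i) η q))]
    have hcut : 2 * η q * heatOp η q + 6 * ∑ i, _root_.dirDeriv (spaceDir i) η q ^ 2 ≤ 2 * A := by
      rw [hη, heatOp_paraCutoff, sum_sq_dirDeriv_paraCutoff, paraCutoff]
      have hr : ‖q.1 - x‖ ^ 2 ≤ R ^ 2 := by gcongr
      have hτ : q.2 - (t - R ^ 2) ≤ R ^ 2 := by linarith [hq.2.2]
      have hτ0 : 0 ≤ q.2 - (t - R ^ 2) := by linarith
      have hr0 : 0 ≤ ‖q.1 - x‖ ^ 2 := by positivity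
      generalize ‖q.1 - x‖ ^ 2 = r at *
      generalize q.2 - (t - R ^ 2) = τ at *
      have h1 : R ^ 2 - r ≤ R ^ 2 := by linarith
      have h2 : 0 ≤ R ^ 2 - r := by linarith
      calc 2 * ((R ^ 2 - r) * τ) * (R ^ 2 - r + 2 * n * τ) + 6 * (4 * r * τ ^ 2)
          ≤ 2 * (R ^ 2 * R ^ 2) * (R ^ 2 + 2 * n * R ^ 2) + 6 * (4 * R ^ 2 * (R ^ 2) ^ 2) := by
            gcongr
        _ = 2 * A := by rw [hA]; ring
    have h1 := mul_le_mul_of_nonneg_left hgrad hA0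
    have h2 := mul_le_mul_of_nonneg_left hcut (sq_nonneg (v q))
    linarith
  have hbd : ∀ q ∈ paraCylinder x t R, ‖q.1 - x‖ = R ∨ q.2 = t - R ^ 2 →
      (η q * v q) * (η q * v q) + A * (u q * u q) ≤ A * K := by
    intro q hq hb
    have h0 : η q = 0 := by rcases hb with h | h <;> simp [hη, paraCutoff, h]
    have := mul_le_mul_of_nonneg_left (hK q hq) hA0
    rw [h0]
    linarith
  have hmem : (x, t) ∈ paraCylinder x t R :=
    ⟨mem_closedBall_self hR.le, by simp; positivity, le_rfl⟩
  have hmain := le_of_heatOp_nonpos hU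
    ((hws.mul hws).add (contDiffOn_const.mul (hus.mul hus))) hQ hsub hbd hmem
  have hη0 : η (x, t) = R ^ 4 := by simp [hη, paraCutoff]; ring
  simp only [hη0] at hmain
  have hu0 : 0 ≤ A * (u (x, t) * u (x, t)) := mul_nonneg hA0 (mul_self_nonneg _)
  refine le_of_mul_le_mul_left ?_ (pow_pos hR 6)
  calc R ^ 6 * (R ^ 2 * v (x, t) ^ 2) = R ^ 4 * v (x, t) * (R ^ 4 * v (x, t)) := by ring
    _ ≤ A * K := by linarith
    _ = _ := by rw [hA]; ring

theorem paraCylinder_subset {x y : EuclideanSpace ℝ (Fin n)} {t s r R : ℝ}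
    (hx : dist y x + r ≤ R) (hs : s ≤ t) (ht : t - R ^ 2 ≤ s - r ^ 2) :
    paraCylinder y s r ⊆ paraCylinder x t R :=
  prod_mono (closedBall_subset_closedBall' (by linarith)) (Icc_subset_Icc ht hs)

/-- The interior estimate for second spatial derivatives. -/
theorem IsCaloricOn.sq_dirDeriv_dirDeriv_le {x : EuclideanSpace ℝ (Fin n)} {t R K : ℝ}
    (hR : 0 < R) (hU : IsOpen U) (hu : IsCaloricOn u U) (hQ : paraCylinder x t R ⊆ U)
    (hK : ∀ q ∈ paraCylinder x t R, u q ^ 2 ≤ K) (i j : Fin n) :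
    R ^ 4 * _root_.dirDeriv (spaceDir i) (_root_.dirDeriv (spaceDir j) u) (x, t) ^ 2 ≤
      16 * (2 * n + 13) ^ 2 * K := by
  have hgrad : ∀ q ∈ paraCylinder x t (R / 2),
      _root_.dirDeriv (spaceDir j) u q ^ 2 ≤ (2 * n + 13) * K / (R / 2) ^ 2 := by
    rintro ⟨y, s⟩ hq
    have hsub : paraCylinder y s (R / 2) ⊆ paraCylinder x t R := by
      refine paraCylinder_subset ?_ hq.2.2 ?_
      · linarith [mem_closedBall.1 hq.1]
      · nlinarith [hq.2.1, sq_nonneg R]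
    rw [le_div_iff₀' (by positivity)]
    exact hu.sq_dirDeriv_le (by positivity) hU (hsub.trans hQ) (fun q hq => hK q (hsub hq)) j
  have hsub : paraCylinder x t (R / 2) ⊆ paraCylinder x t R :=
    paraCylinder_subset (by rw [dist_self]; linarith) le_rfl (by nlinarith [sq_nonneg R])
  have h := (hu.dirDeriv hU (spaceDir j)).sq_dirDeriv_le (by positivity) hU (hsub.trans hQ) hgrad i
  have h' := mul_le_mul_of_nonneg_left h (show 0 ≤ 4 * R ^ 2 by positivity)
  have e : 4 * R ^ 2 * ((2 * n + 13) * ((2 * n + 13) * K / (R / 2) ^ 2)) =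
      16 * (2 * (n : ℝ) + 13) ^ 2 * K := by field_simp; ring
  rw [e] at h'
  linarith

theorem isCaloricOn_of_deriv_eq_lap (hU : IsOpen U) (hu : ContDiffOn ℝ ∞ u U)
    (hpde : ∀ p ∈ U, deriv (fun s => u (p.1, s)) p.2 = lap (fun y => u (y, p.2)) p.1) :
    IsCaloricOn u U where
  smooth := hu
  heatOp_eq_zero := by
    rintro ⟨a, s⟩ hp
    have hd := hu.differentiableAt_of_isOpen hU hp
    have htime : deriv (fun r => u (a, r)) s = dirDeriv (0, 1) u (a, s) := by
      have h : HasFDerivAt (fun r : ℝ => (a, r)) (ContinuousLinearMap.inr ℝ _ ℝ) s :=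
        hasFDerivAt_prodMk_right a s
      have h' : HasFDerivAt (fun r => u (a, r)) _ s := hd.hasFDerivAt.comp s h
      simpa [dirDeriv] using h'.hasDerivAt.deriv
    have hlap : lap (fun y => u (y, s)) a =
        ∑ i, dirDeriv (spaceDir i) (dirDeriv (spaceDir i) u) (a, s) :=
      Finset.sum_congr rfl fun i _ =>
        dirDeriv_dirDeriv_slice hU hu hp (EuclideanSpace.single i 1)
    rw [heatOp, ← htime, ← hlap, hpde _ hp, sub_self]

/-- Parabolic growth `o(R²)` of an ancient solution makes its second spatial derivatives vanish. -/
theorem IsCaloricOn.dirDeriv_dirDeriv_eq_zero {t₀ : ℝ} {x₀ : EuclideanSpace ℝ (Fin n)}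
    (hu : IsCaloricOn u {p | p.2 < t₀})
    (hgrowth : ∀ ε > 0, ∀ᶠ R : ℝ in atTop, ∀ q ∈ paraCylinder x₀ t₀ R, |u q| ≤ ε * R ^ 2)
    (hp : p.2 < t₀) (i j : Fin n) :
    _root_.dirDeriv (spaceDir i) (_root_.dirDeriv (spaceDir j) u) p = 0 := by
  obtain ⟨x, t⟩ := p
  have hU : IsOpen {p : EuclideanSpace ℝ (Fin n) × ℝ | p.2 < t₀} :=
    isOpen_lt continuous_snd continuous_const
  replace hp : t < t₀ := hp
  set w := _root_.dirDeriv (spaceDir i) (_root_.dirDeriv (spaceDir j) u) (x, t)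
  set d := dist x x₀ + (t₀ - t) with hd
  have hd0 : 0 ≤ d := add_nonneg dist_nonneg (by linarith)
  have key (ε : ℝ) (hε : 0 < ε) : w ^ 2 ≤ (256 * (2 * n + 13) ^ 2) * ε ^ 2 := by
    obtain ⟨R, hR, hR1, hRd⟩ := (((tendsto_atTop_add_const_right atTop d tendsto_id).eventually
      (hgrowth ε hε)).and ((eventually_ge_atTop (1 : ℝ)).and (eventually_ge_atTop d))).exists
    simp only [id] at hR
    have hsub : paraCylinder x t R ⊆ paraCylinder x₀ t₀ (R + d) := by
      refine paraCylinder_subset ?_ hp.le ?_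
      · linarith
      · have : t₀ - t ≤ d := by linarith [dist_nonneg (x := x) (y := x₀)]
        nlinarith [mul_le_mul_of_nonneg_right hR1 hd0, sq_nonneg d]
    have hK : ∀ q ∈ paraCylinder x t R, u q ^ 2 ≤ 16 * ε ^ 2 * R ^ 4 := by
      intro q hq
      calc u q ^ 2 = |u q| ^ 2 := (sq_abs _).symm
        _ ≤ (ε * (R + d) ^ 2) ^ 2 := by gcongr; exact hR q (hsub hq)
        _ ≤ (ε * (R + R) ^ 2) ^ 2 := by gcongr
        _ = _ := by ring
    have h := hu.sq_dirDeriv_dirDeriv_le (by linarith) hU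
      (fun q hq => lt_of_le_of_lt hq.2.2 hp) hK i j
    refine le_of_mul_le_mul_left ?_ (show 0 < R ^ 4 by positivity)
    linarith
  have hlim : Tendsto (fun ε : ℝ => (256 * (2 * (n : ℝ) + 13) ^ 2) * ε ^ 2) (𝓝[>] 0) (𝓝 0) := by
    have : Continuous fun ε : ℝ => (256 * (2 * (n : ℝ) + 13) ^ 2) * ε ^ 2 := by fun_prop
    simpa using (this.tendsto 0).mono_left nhdsWithin_le_nhds
  have h0 : w ^ 2 ≤ 0 :=
    ge_of_tendsto hlim (by filter_upwards [self_mem_nhdsWithin] with ε hε using key ε hε)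
  exact pow_eq_zero_iff two_ne_zero |>.1 (le_antisymm h0 (sq_nonneg w))

/-- A positive function on a line whose second derivative vanishes has zero derivative. -/
theorem hasDerivAt_eq_zero_of_pos {φ ψ : ℝ → ℝ} (hφ : ∀ s, HasDerivAt φ (ψ s) s)
    (hψ : ∀ s, HasDerivAt ψ 0 s) (hpos : ∀ s, 0 < φ s) (s : ℝ) : ψ s = 0 := by
  have hψc (r : ℝ) : ψ r = ψ s :=
    is_const_of_deriv_eq_zero (fun r => (hψ r).differentiableAt) (fun r => (hψ r).deriv) r s
  by_contra hne
  have hlin (r : ℝ) : HasDerivAt (fun r => φ r - ψ s * r) 0 r := by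
    simpa [hψc r] using (hφ r).fun_sub ((hasDerivAt_id r).const_mul (ψ s))
  have h := is_const_of_deriv_eq_zero (fun r => (hlin r).differentiableAt)
    (fun r => (hlin r).deriv) (-φ 0 / ψ s) 0
  have hz : φ (-φ 0 / ψ s) = 0 := by
    rw [mul_div_cancel₀ _ hne] at h
    linarith
  exact (hpos _).ne' hz

/-- An affine-in-space positive solution of the heat equation on a half-space is constant. -/
theorem IsCaloricOn.eq_of_dirDeriv_dirDeriv_eq_zero {t₀ : ℝ} (hu : IsCaloricOn u {p | p.2 < t₀})
    (hpos : ∀ p : EuclideanSpace ℝ (Fin n) × ℝ, p.2 < t₀ → 0 < u p)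
    (hzero : ∀ p : EuclideanSpace ℝ (Fin n) × ℝ, p.2 < t₀ → ∀ i,
      _root_.dirDeriv (spaceDir i) (_root_.dirDeriv (spaceDir i) u) p = 0)
    {p q : EuclideanSpace ℝ (Fin n) × ℝ} (hp : p.2 < t₀) (hq : q.2 < t₀) : u p = u q := by
  have hU : IsOpen {p : EuclideanSpace ℝ (Fin n) × ℝ | p.2 < t₀} :=
    isOpen_lt continuous_snd continuous_const
  have hconv : Convex ℝ {p : EuclideanSpace ℝ (Fin n) × ℝ | p.2 < t₀} :=
    (convex_Iio t₀).linear_preimage (LinearMap.snd ℝ _ ℝ)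
  have htime (p : EuclideanSpace ℝ (Fin n) × ℝ) (hp : p.2 < t₀) : fderiv ℝ u p (0, 1) = 0 := by
    have := hu.heatOp_eq_zero p hp
    rwa [heatOp, Finset.sum_eq_zero fun i _ => hzero p hp i, sub_zero] at this
  have hspace (p : EuclideanSpace ℝ (Fin n) × ℝ) (hp : p.2 < t₀) (i : Fin n) :
      fderiv ℝ u p (EuclideanSpace.single i 1, 0) = 0 := by
    have hline (s : ℝ) : (p + s • spaceDir i).2 < t₀ := by simpa [spaceDir] using hp
    have := hasDerivAt_eq_zero_of_pos
      (fun s => hasDerivAt_comp_add_smul (spaceDir i) s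
        (hu.smooth.differentiableAt_of_isOpen hU (hline s)))
      (fun s => by
        simpa only [hzero _ (hline s)] using hasDerivAt_comp_add_smul (spaceDir i) s
          ((hu.smooth.dirDeriv hU (spaceDir i)).differentiableAt_of_isOpen hU (hline s)))
      (fun s => hpos _ (hline s)) 0
    simpa [_root_.dirDeriv, spaceDir] using this
  refine hU.is_const_of_fderiv_eq_zero (𝕜 := ℝ) hconv.isPreconnected
    (hu.smooth.differentiableOn (by simp)) (fun p hp => ?_) hp hq
  have hinl : (fderiv ℝ u p).comp (ContinuousLinearMap.inl ℝ _ ℝ) = 0 := by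
    refine ContinuousLinearMap.coe_injective
      ((EuclideanSpace.basisFun (Fin n) ℝ).toBasis.ext fun i => ?_)
    simpa using hspace p hp i
  refine ContinuousLinearMap.prod_ext (by simpa using hinl) ?_
  ext
  simpa using htime p hp

end HeatOperator

/-- Theorem 4.2 (Euclidean case): Liouville theorem for the heat equation.
If `u` is a smooth positive ancient solution of `u_t = Δu` on `ℝⁿ × (−∞, t₀]` with
`sup_{B(x₀,R) × [t₀−R², t₀]} u = o(R²)` as `R → ∞`, then `u` is constant. -/
theorem liouville_heat (n : ℕ) (hn : 1 ≤ n) (t₀ : ℝ)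
    (u : EuclideanSpace ℝ (Fin n) × ℝ → ℝ)
    (hu : ContDiffOn ℝ (⊤ : ℕ∞) u {p | p.2 ≤ t₀})
    (hpos : ∀ p : EuclideanSpace ℝ (Fin n) × ℝ, p.2 ≤ t₀ → 0 < u p)
    (hpde : ∀ p : EuclideanSpace ℝ (Fin n) × ℝ, p.2 ≤ t₀ →
      deriv (fun s => u (p.1, s)) p.2 = lap (fun y => u (y, p.2)) p.1)
    (x₀ : EuclideanSpace ℝ (Fin n))
    (hgrowth : (fun R : ℝ =>
        sSup (u '' (closedBall x₀ R ×ˢ Icc (t₀ - R ^ 2) t₀)))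
      =o[atTop] fun R : ℝ => R ^ 2) :
    ∀ p q : EuclideanSpace ℝ (Fin n) × ℝ, p.2 ≤ t₀ → q.2 ≤ t₀ → u p = u q := by
  set S := {p : EuclideanSpace ℝ (Fin n) × ℝ | p.2 ≤ t₀}
  set U := {p : EuclideanSpace ℝ (Fin n) × ℝ | p.2 < t₀} with hUdef
  have hUS : U ⊆ S := fun p (hp : p.2 < t₀) => hp.le
  have hU : IsOpen U := isOpen_lt continuous_snd continuous_const
  have hcal : IsCaloricOn u U :=
    isCaloricOn_of_deriv_eq_lap hU (hu.mono hUS) fun p hp => hpde p (hUS hp)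
  have hgrowth' : ∀ ε > 0, ∀ᶠ R : ℝ in atTop, ∀ q ∈ paraCylinder x₀ t₀ R,
      |u q| ≤ ε * R ^ 2 := by
    intro ε hε
    filter_upwards [hgrowth.bound hε] with R hR q hq
    have hbdd : BddAbove (u '' paraCylinder x₀ t₀ R) :=
      ((isCompact_paraCylinder x₀ t₀ R).image_of_continuousOn
        (hu.continuousOn.mono fun q hq => hq.2.2)).bddAbove
    rw [abs_of_pos (hpos q hq.2.2)]
    rw [Real.norm_of_nonneg (sq_nonneg R)] at hR
    exact (le_csSup hbdd (mem_image_of_mem u hq)).trans ((le_abs_self _).trans hR)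
  have hconst {p q : EuclideanSpace ℝ (Fin n) × ℝ} (hp : p ∈ U) (hq : q ∈ U) : u p = u q :=
    hcal.eq_of_dirDeriv_dirDeriv_eq_zero (fun p hp => hpos p (hUS hp))
      (fun p hp i => hcal.dirDeriv_dirDeriv_eq_zero hgrowth' hp i i) hp hq
  have hbase : (x₀, t₀ - 1) ∈ U := by simp [hUdef]
  have hclosure : S ⊆ closure U := by
    rintro ⟨a, s⟩ hs
    have : U = univ ×ˢ Iio t₀ := by ext; simp [hUdef]
    rw [this, closure_prod_eq, closure_univ, closure_Iio]
    exact ⟨mem_univ _, hs⟩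
  have heq : EqOn u (fun _ => u (x₀, t₀ - 1)) S :=
    EqOn.of_subset_closure (fun p hp => hconst hp hbase) hu.continuousOn continuousOn_const
      hUS hclosure
  intro p q hp hq
  exact (heq hp).trans (heq hq).symm
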